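/- If match((C_2, E_2), {(C_1, E_1)}) holds, no pair in E_1 or E_2 has kind HDR, and U ⊆ D, then match((C_2, E_2 ∪ {(HDR, U)}), {(C_1, E_1 ∪ {(HDR, U)})}) holds; i.e., adding a routing-slip header with the same data element set U to both the outbound contract of the sender and the inbound contract of the receiver preserves matching. -/

import Mathlib

/-- Message part kinds. -/
inductive MKind | HDR | PL | ATTCH
deriving DecidableEq

/-- Message properties. -/
inductive MProp | signed | encrypted | encoded
deriving DecidableEq

/-- Property values. -/
inductive TriVal | yes | no | any
deriving DecidableEq

/-- A pattern contract: a property component and a data-element component. -/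
abbrev PContract (D : Type) := (MProp → TriVal) × Set (MKind × Set D)

/-- `cMatch c X`: the pattern contract `c` matches the set `X` of pattern contracts. -/
def cMatch {D : Type} (c : PContract D) (X : Set (PContract D)) : Prop :=
  (∀ x : MProp, c.1 x ≠ TriVal.any →
    ∀ c' ∈ X, c'.1 x = c.1 x ∨ c'.1 x = TriVal.any) ∧
  (∀ m Z, (m, Z) ∈ c.2 →
    Z = {d | ∃ c' ∈ X, ∃ Z', (m, Z') ∈ c'.2 ∧ d ∈ Z'})


/-- adding a routing-slip header with the same data element set `U`
to both the outbound contract of the sender and the inbound contract of the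
receiver preserves matching, provided neither contract mentions a header. -/
theorem add_header_matches {D : Type}
    (C1 C2 : MProp → TriVal) (E1 E2 : Set (MKind × Set D)) (U : Set D)
    (h : cMatch (C2, E2) {(C1, E1)})
    (h1 : ∀ Z : Set D, (MKind.HDR, Z) ∉ E1)
    (h2 : ∀ Z : Set D, (MKind.HDR, Z) ∉ E2) :
    cMatch (C2, E2 ∪ {(MKind.HDR, U)}) {(C1, E1 ∪ {(MKind.HDR, U)})} := by
  obtain ⟨hprops, hdata⟩ := h
  refine ⟨fun x hx c' hc' => ?_, fun m Z hZ => ?_⟩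
  · rw [Set.mem_singleton_iff.mp hc']
    exact hprops x hx (C1, E1) rfl
  · ext d
    rcases hZ with hZ | hZ
    · have hm : m ≠ MKind.HDR := by
        rintro rfl
        exact h2 Z hZ
      rw [hdata m Z hZ]
      simp [hm]
    · obtain ⟨rfl, rfl⟩ := Prod.mk.inj hZ
      simp [h1]
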